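/- The Lebesgue measure on the cone of positive definite symmetric n×n matrices transforms under S ↦ g S gᵀ with Jacobian |det g|^{n+1}; equivalently, the measure det(S)^{-(n+1)/2} dS is invariant under this GL(n,ℝ)-action. -/

import Mathlib

open Matrix MeasureTheory

instance {n : ℕ} : MeasurableSpace (Matrix (Fin n) (Fin n) ℝ) := borel _
instance {n : ℕ} : BorelSpace (Matrix (Fin n) (Fin n) ℝ) := ⟨rfl⟩

/-- The space `Sym(n, ℝ)` of real symmetric `n × n` matrices, as a submodule of the space
of matrices. -/
def symMat (n : ℕ) : Submodule ℝ (Matrix (Fin n) (Fin n) ℝ) where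
  carrier := {X | X.IsSymm}
  add_mem' := fun ha hb => ha.add hb
  zero_mem' := Matrix.isSymm_zero
  smul_mem' := fun c _ h => h.smul c

/-- The congruence map `S ↦ g * S * gᵀ` on symmetric matrices. -/
def congrMap {n : ℕ} (g : Matrix (Fin n) (Fin n) ℝ) (S : symMat n) : symMat n :=
  ⟨g * (S : Matrix (Fin n) (Fin n) ℝ) * gᵀ, by
    have hS : (S : Matrix (Fin n) (Fin n) ℝ).IsSymm := S.2
    simp [symMat, Matrix.IsSymm, Matrix.transpose_mul, hS.eq, Matrix.mul_assoc]⟩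

namespace symMat

variable {n : ℕ}

/-- The congruence map as a linear endomorphism of the space of symmetric matrices. -/
def congrLinear (g : Matrix (Fin n) (Fin n) ℝ) : symMat n →ₗ[ℝ] symMat n where
  toFun := congrMap g
  map_add' S T := by
    ext1
    simp [congrMap, Matrix.mul_add, Matrix.add_mul]
  map_smul' c S := by
    ext1
    simp [congrMap]

@[simp]
theorem coe_congrLinear_apply (g : Matrix (Fin n) (Fin n) ℝ) (S : symMat n) :
    (congrLinear g S : Matrix (Fin n) (Fin n) ℝ) = g * (S : Matrix (Fin n) (Fin n) ℝ) * gᵀ :=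
  rfl

theorem congrLinear_one : congrLinear (1 : Matrix (Fin n) (Fin n) ℝ) = LinearMap.id := by
  ext1 S
  ext1
  simp

theorem congrLinear_mul (g h : Matrix (Fin n) (Fin n) ℝ) :
    congrLinear (g * h) = congrLinear g ∘ₗ congrLinear h := by
  ext1 S
  ext1
  simp [Matrix.transpose_mul, Matrix.mul_assoc]

/-- A symmetric matrix is determined by its entries on and above the diagonal. -/
def upperEquiv (n : ℕ) : symMat n ≃ₗ[ℝ] ({p : Fin n × Fin n // p.1 ≤ p.2} → ℝ) where
  toFun S p := (S : Matrix (Fin n) (Fin n) ℝ) p.1.1 p.1.2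
  map_add' _ _ := rfl
  map_smul' _ _ := rfl
  invFun v := ⟨Matrix.of fun i j => v ⟨(min i j, max i j), min_le_max⟩, by
    ext i j
    simp [min_comm, max_comm]⟩
  left_inv S := by
    ext i j
    have hS : (S : Matrix (Fin n) (Fin n) ℝ).IsSymm := S.2
    rcases le_total i j with h | h
    · simp [h]
    · simp [h, hS.apply]
  right_inv v := by
    ext ⟨⟨i, j⟩, h⟩
    have h' : i ≤ j := h
    simp [h']

theorem prod_upper_mul (d : Fin n → ℝ) :
    ∏ p : {p : Fin n × Fin n // p.1 ≤ p.2}, d p.1.1 * d p.1.2 = (∏ i, d i) ^ (n + 1) := by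
  rw [← Finset.prod_subtype (Finset.univ.filter fun p : Fin n × Fin n => p.1 ≤ p.2) (by simp)
    fun p => d p.1 * d p.2, Finset.prod_mul_distrib, Finset.prod_filter, Finset.prod_filter,
    Fintype.prod_prod_type, Fintype.prod_prod_type_right, ← Finset.prod_mul_distrib,
    ← Finset.prod_pow]
  refine Finset.prod_congr rfl fun i _ => ?_
  have h (j : Fin n) : (if i ≤ j then d i else 1) * (if j ≤ i then d i else 1) =
      d i * if i = j then d i else 1 := by
    rcases lt_trichotomy i j with h | rfl | h
    · simp [h.le, h.not_ge, h.ne]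
    · simp
    · simp [h.le, h.not_ge, h.ne']
  rw [← Finset.prod_mul_distrib, Finset.prod_congr rfl fun j _ => h j, Finset.prod_mul_distrib]
  simp [pow_succ]

theorem det_congrLinear_diagonal (d : Fin n → ℝ) :
    LinearMap.det (congrLinear (diagonal d)) = (diagonal d).det ^ (n + 1) := by
  rw [det_diagonal, ← prod_upper_mul, ← LinearMap.det_conj _ (upperEquiv n)]
  have : (upperEquiv n : symMat n →ₗ[ℝ] _) ∘ₗ congrLinear (diagonal d) ∘ₗ
      ((upperEquiv n).symm : _ →ₗ[ℝ] symMat n) =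
      LinearMap.pi fun p : {p : Fin n × Fin n // p.1 ≤ p.2} =>
        ((d p.1.1 * d p.1.2) • LinearMap.id (R := ℝ) (M := ℝ)) ∘ₗ LinearMap.proj p := by
    refine LinearMap.ext fun v => funext fun ⟨⟨i, j⟩, h⟩ => ?_
    have h' : i ≤ j := h
    change (diagonal d * (Matrix.of fun i j => v ⟨(min i j, max i j), min_le_max⟩) *
      (diagonal d)ᵀ : Matrix (Fin n) (Fin n) ℝ) i j = _
    simp [h']
    ring
  rw [this, LinearMap.det_pi]
  simp

theorem det_congrLinear_transvection {i j : Fin n} (hij : i ≠ j) (c : ℝ) :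
    LinearMap.det (congrLinear (transvection i j c)) = 1 := by
  set f : ℝ → ℝ := fun c => LinearMap.det (congrLinear (transvection i j c)) with hf
  have hadd (a b : ℝ) : f (a + b) = f a * f b := by
    simp only [hf, ← transvection_mul_transvection_same _ _ hij, congrLinear_mul, LinearMap.det_comp]
  have hzero : f 0 = 1 := by
    simp [hf, congrLinear_one]
  have hne : f c ≠ 0 := by
    intro h
    have := hadd c (-c)
    simp [h, hzero] at this
  set D : Matrix (Fin n) (Fin n) ℝ := diagonal (Function.update 1 i 2) with hD
  have hcomm : D * transvection i j c = transvection i j (c + c) * D := by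
    ext a b
    simp only [hD, transvection, diagonal_mul, mul_diagonal, Matrix.add_apply, Matrix.one_apply,
      Matrix.single_apply, Function.update_apply, Pi.one_apply]
    grind
  have hDne : LinearMap.det (congrLinear D) ≠ 0 := by
    rw [hD, det_congrLinear_diagonal, det_diagonal]
    refine pow_ne_zero _ (Finset.prod_ne_zero_iff.2 fun k _ => ?_)
    rcases eq_or_ne k i with rfl | hk <;> simp [*]
  have h := congrArg (fun M => LinearMap.det (congrLinear M)) hcomm
  simp only [congrLinear_mul, LinearMap.det_comp] at h
  rw [mul_comm] at h
  have h2 : f c = f c * f c := (mul_right_cancel₀ hDne h).trans (hadd c c)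
  exact (mul_eq_left₀ hne).1 h2.symm

theorem det_congrLinear (g : Matrix (Fin n) (Fin n) ℝ) :
    LinearMap.det (congrLinear g) = g.det ^ (n + 1) := by
  induction g using diagonal_transvection_induction with
  | hdiag D _ => exact det_congrLinear_diagonal D
  | htransvec t =>
    rw [TransvectionStruct.toMatrix, det_congrLinear_transvection t.hij]
    simp [det_transvection_of_ne _ _ t.hij]
  | hmul A B hA hB => rw [congrLinear_mul, LinearMap.det_comp, hA, hB, det_mul, mul_pow]

theorem measure_image_congrMap (μ : Measure (symMat n)) [μ.IsAddHaarMeasure]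
    (g : Matrix (Fin n) (Fin n) ℝ) (E : Set (symMat n)) :
    μ (congrMap g '' E) = ENNReal.ofReal (|g.det| ^ (n + 1)) * μ E := by
  have hB : BorelSpace (symMat n) := inferInstance
  let : NormedAddCommGroup (Matrix (Fin n) (Fin n) ℝ) := Matrix.normedAddCommGroup
  let : NormedSpace ℝ (Matrix (Fin n) (Fin n) ℝ) := Matrix.normedSpace
  have h := @Measure.addHaar_image_linearMap (symMat n) _ _ _ hB _ μ ‹_› (congrLinear g) E
  rwa [det_congrLinear, abs_pow] at h

theorem continuous_congrMap (g : Matrix (Fin n) (Fin n) ℝ) : Continuous (congrMap g) := by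
  unfold congrMap
  fun_prop

theorem congrMap_congrMap (g h : Matrix (Fin n) (Fin n) ℝ) (S : symMat n) :
    congrMap g (congrMap h S) = congrMap (g * h) S :=
  (LinearMap.congr_fun (congrLinear_mul g h) S).symm

theorem congrMap_one (S : symMat n) : congrMap 1 S = S :=
  LinearMap.congr_fun congrLinear_one S

/-- Congruence by an invertible matrix is a homeomorphism of the space of symmetric matrices. -/
def congrHomeomorph (g : (Matrix (Fin n) (Fin n) ℝ)ˣ) : symMat n ≃ₜ symMat n where
  toFun := congrMap (g : Matrix (Fin n) (Fin n) ℝ)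
  invFun := congrMap (g⁻¹ : (Matrix (Fin n) (Fin n) ℝ)ˣ)
  left_inv S := by rw [congrMap_congrMap, Units.inv_mul, congrMap_one]
  right_inv S := by rw [congrMap_congrMap, Units.mul_inv, congrMap_one]
  continuous_toFun := continuous_congrMap _
  continuous_invFun := continuous_congrMap _

theorem measurableSet_posDef :
    MeasurableSet {S : symMat n | (S : Matrix (Fin n) (Fin n) ℝ).PosDef} := by
  have h : {S : symMat n | (S : Matrix (Fin n) (Fin n) ℝ).PosDef} =
      (⋂ x : Fin n → ℝ, {S : symMat n | 0 ≤ x ⬝ᵥ ((S : Matrix (Fin n) (Fin n) ℝ) *ᵥ x)}) ∩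
        {S : symMat n | (S : Matrix (Fin n) (Fin n) ℝ).det ≠ 0} := by
    ext S
    have hS : (S : Matrix (Fin n) (Fin n) ℝ).IsHermitian := S.2
    simp only [Set.mem_ofPred_eq, Set.mem_inter_iff, Set.mem_iInter]
    constructor
    · exact fun h => ⟨h.posSemidef.dotProduct_mulVec_nonneg, h.det_pos.ne'⟩
    · exact fun h => (PosSemidef.of_dotProduct_mulVec_nonneg hS h.1).posDef_iff_det_ne_zero.2 h.2
  rw [h]
  refine (isClosed_iInter fun x => isClosed_le continuous_const ?_).measurableSet.inter
    (isOpen_ne_fun ?_ continuous_const).measurableSet <;> fun_prop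

theorem posDef_congrMap_iff {g : Matrix (Fin n) (Fin n) ℝ} (hg : IsUnit g) (S : symMat n) :
    (congrMap g S : Matrix (Fin n) (Fin n) ℝ).PosDef ↔ (S : Matrix (Fin n) (Fin n) ℝ).PosDef :=
  hg.posDef_star_right_conjugate_iff

theorem det_congrMap_rpow (g : Matrix (Fin n) (Fin n) ℝ) (S : symMat n)
    (hS : 0 ≤ (S : Matrix (Fin n) (Fin n) ℝ).det) :
    (congrMap g S : Matrix (Fin n) (Fin n) ℝ).det ^ (-(((n : ℝ) + 1) / 2)) =
      (|g.det| ^ (n + 1))⁻¹ * (S : Matrix (Fin n) (Fin n) ℝ).det ^ (-(((n : ℝ) + 1) / 2)) := by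
  have h : (congrMap g S : Matrix (Fin n) (Fin n) ℝ).det =
      |g.det| ^ 2 * (S : Matrix (Fin n) (Fin n) ℝ).det := by
    simp only [congrMap, det_mul, det_transpose, sq_abs]
    ring
  rw [h, Real.mul_rpow (by positivity) hS, ← Real.rpow_natCast, ← Real.rpow_mul (abs_nonneg _),
    ← Real.rpow_natCast, ← Real.rpow_neg (abs_nonneg _)]
  congr 2
  push_cast
  ring

end symMat

/-- Any (Haar–)Lebesgue measure `μ` on `Sym(n, ℝ)` transforms under `S ↦ g S gᵀ` with
Jacobian `|det g|^{n+1}`; equivalently, the measure `det(S)^{-(n+1)/2} dS` restricted to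
the cone of positive definite matrices is invariant under this `GL(n, ℝ)`-action. -/
theorem stmt_15 {n : ℕ} (μ : Measure (symMat n)) [μ.IsAddHaarMeasure]
    (g : Matrix (Fin n) (Fin n) ℝ) (hg : IsUnit g) :
    (∀ E : Set (symMat n), MeasurableSet E →
        μ (congrMap g '' E) = ENNReal.ofReal (|g.det| ^ (n + 1)) * μ E) ∧
    Measure.map (congrMap g)
        ((μ.restrict {S : symMat n | (S : Matrix (Fin n) (Fin n) ℝ).PosDef}).withDensity
          fun S => ENNReal.ofReal
            ((S : Matrix (Fin n) (Fin n) ℝ).det ^ (-(((n : ℝ) + 1) / 2)))) =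
      (μ.restrict {S : symMat n | (S : Matrix (Fin n) (Fin n) ℝ).PosDef}).withDensity
        fun S => ENNReal.ofReal
          ((S : Matrix (Fin n) (Fin n) ℝ).det ^ (-(((n : ℝ) + 1) / 2))) := by
  refine ⟨fun E _ => symMat.measure_image_congrMap μ g E, ?_⟩
  set P : Set (symMat n) := {S : symMat n | (S : Matrix (Fin n) (Fin n) ℝ).PosDef}
  set f : symMat n → ENNReal := fun S => ENNReal.ofReal
    ((S : Matrix (Fin n) (Fin n) ℝ).det ^ (-(((n : ℝ) + 1) / 2))) with hf
  have hPm : MeasurableSet P := symMat.measurableSet_posDef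
  have hdet : 0 < |g.det| ^ (n + 1) :=
    pow_pos (abs_pos.2 ((isUnit_iff_isUnit_det g).1 hg).ne_zero) _
  set c : ENNReal := ENNReal.ofReal (|g.det| ^ (n + 1)) with hc
  have hc0 : c ≠ 0 := (ENNReal.ofReal_pos.2 hdet).ne'
  have hctop : c ≠ ⊤ := ENNReal.ofReal_ne_top
  let e : symMat n ≃ᵐ symMat n := (symMat.congrHomeomorph hg.unit).toMeasurableEquiv
  have he : ⇑e = congrMap g := rfl
  have hμ : μ = c • Measure.map e μ := by
    ext A hA
    rw [Measure.smul_apply, e.map_apply, smul_eq_mul, ← symMat.measure_image_congrMap μ g, ← he,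
      e.image_preimage]
  have hpre : e ⁻¹' P = P := Set.ext fun S => symMat.posDef_congrMap_iff hg S
  have hfe : ∀ S ∈ P, c * f (e S) = f S := by
    intro S hS
    simp only [hf, hc, he]
    rw [symMat.det_congrMap_rpow g S hS.det_pos.le, ← ENNReal.ofReal_mul hdet.le,
      mul_inv_cancel_left₀ hdet.ne']
  rw [← he]
  ext A hA
  have hAm : MeasurableSet (e ⁻¹' A) := e.measurable hA
  rw [e.map_apply, withDensity_apply _ hAm, withDensity_apply _ hA, Measure.restrict_restrict hAm,
    Measure.restrict_restrict hA]
  symm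
  calc ∫⁻ S in A ∩ P, f S ∂μ
      = c * ∫⁻ S in A ∩ P, f S ∂(Measure.map e μ) := by
        conv_lhs => rw [hμ]
        rw [Measure.restrict_smul, lintegral_smul_measure, smul_eq_mul]
    _ = c * ∫⁻ S in e ⁻¹' A ∩ P, f (e S) ∂μ := by
        rw [e.restrict_map, lintegral_map_equiv, Set.preimage_inter, hpre]
    _ = ∫⁻ S in e ⁻¹' A ∩ P, c * f (e S) ∂μ := (lintegral_const_mul' _ _ hctop).symm
    _ = ∫⁻ S in e ⁻¹' A ∩ P, f S ∂μ :=
        setLIntegral_congr_fun (hAm.inter hPm) fun S hS => hfe S hS.2
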